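/- For all integers m,n with 1 ≤ m ≤ n−2 and (m,n) ≠ (1,3): t^(m)(n) = 1 + ⌈ν_m·(m+1)^{⌈ν_{m+1}·(m+2)^{···^{⌈ν_{n−2}·(n−1)⌉}}⌉}⌉. Precisely, defining integers E_j for m ≤ j ≤ n−2 by downward recursion E_{n−2} := ⌈ν_{n−2}·(n−1)⌉ and E_j := ⌈ν_j·(j+1)^{E_{j+1}}⌉ for m ≤ j ≤ n−3, one has t^(m)(n) = 1 + E_m. -/

import Mathlib

open List Filter

open scoped Classical

noncomputable section

/-- The curling number of a finite string: the largest `k` such that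
`S = X ++ Y^k` with `Y` nonempty; by convention `curl [] = 1`. -/
def curl (S : List ℕ) : ℕ :=
  max 1 (sSup {k | ∃ X Y : List ℕ, Y ≠ [] ∧ S = X ++ (List.replicate k Y).flatten})

/-- The prefix of length `n` of the level-`m` Gijswijt sequence `A^(m)`. -/
def gPrefix (m : ℕ) : ℕ → List ℕ
  | 0 => []
  | n + 1 => gPrefix m n ++ [max m (curl (gPrefix m n))]

/-- `gij m p` is the `p`-th term (1-indexed) of the level-`m` Gijswijt sequence `A^(m)`. -/
def gij (m p : ℕ) : ℕ := max m (curl (gPrefix m (p - 1)))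

/-- Standing hypothesis: for every `m ≥ 1`, the sets
`{k ≥ 0 : C(A^(m)[1,k]) ≤ m}` and `{k ≥ 0 : C(A^(m+1)[1,k]) ≤ m}` are infinite. -/
def StandingHyp : Prop :=
  ∀ m : ℕ, 1 ≤ m →
    {k : ℕ | curl (gPrefix m k) ≤ m}.Infinite ∧
    {k : ℕ | curl (gPrefix (m + 1) k) ≤ m}.Infinite

/-- Length of `π^(m)(1,x)`: the `x`-th smallest (0-indexed) element of
`{k : C(A^(m)[1,k]) ≤ m}`. -/
def piLen (m x : ℕ) : ℕ := Nat.nth (fun k => curl (gPrefix m k) ≤ m) x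

/-- `π^(m)(1,x)`: the prefix of `A^(m)` with exactly `x` occurrences of `m`
and curling number at most `m`. -/
def piStr (m x : ℕ) : List ℕ := gPrefix m (piLen m x)

/-- `β^(m)(t)`, the length of `B_t^(m)`. -/
def beta (m t : ℕ) : ℕ := piLen m ((m + 1) ^ (t - 1))

/-- `B_t^(m) := π^(m)(1,(m+1)^(t-1))`. -/
def Bstr (m t : ℕ) : List ℕ := piStr m ((m + 1) ^ (t - 1))

/-- `τ^(m)(t)`, the length of `T_t^(m)`. -/
def tau (m t : ℕ) : ℕ := Nat.nth (fun k => curl (gPrefix (m + 1) k) ≤ m) (t - 1)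

/-- `T_t^(m)`: the `t`-th shortest prefix of `A^(m+1)` with curling number at most `m`. -/
def Tstr (m t : ℕ) : List ℕ := gPrefix (m + 1) (tau m t)

/-- `φ^(m)(n)`: the least `p ≥ 1` with `A^(m)(p) = n`. -/
def phi (m n : ℕ) : ℕ := sInf {p : ℕ | 1 ≤ p ∧ gij m p = n}

/-- `t^(m)(n) = 1 + log_{m+1} #\{i ≤ φ^(m)(n) : A^(m)(i) = m\}`. -/
def tfun (m n : ℕ) : ℕ := 1 + Nat.log (m + 1) ((gPrefix m (phi m n)).count m)

/-- `χ^(b)(a)`: read the base-`b` digits of `a` as base-`(b+1)` digits. -/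
def chi (b a : ℕ) : ℕ := Nat.ofDigits (b + 1) (Nat.digits b a)

/-- `ι_m(t)`: read the base-`(m+2)` digits of the number of occurrences of `m+1`
in `T_t^(m)` as base-`(m+1)` digits. -/
def iota (m t : ℕ) : ℕ :=
  Nat.ofDigits (m + 1) (Nat.digits (m + 2) ((Tstr m t).count (m + 1)))

/-- `ι_m⁻¹(p)`: the largest `x ≥ 1` with `ι_m(x) ≤ p`. -/
def iotaInv (m p : ℕ) : ℕ := sSup {x : ℕ | 1 ≤ x ∧ iota m x ≤ p}

/-- `ord_b(n)`: the `b`-adic valuation of `n`. -/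
def ordb (b n : ℕ) : ℕ := sSup {z : ℕ | b ^ z ∣ n}

/-- The largest base-`b` digit of `n`. -/
def maxdigit (b n : ℕ) : ℕ := (Nat.digits b n).foldr max 0

/-- Auxiliary function for the level-`m` expansion: `lexpAux m a k = a_{m+1+k}`. -/
def lexpAux (m a : ℕ) : ℕ → ℕ
  | 0 => a
  | k + 1 => iota (m + 1 + k) (ordb (m + 1 + k) (lexpAux m a k) + 1)

/-- `lexp m a l = a_l`, the `l`-th term of the level-`m` expansion of `a`. -/
def lexp (m a l : ℕ) : ℕ := lexpAux m a (l - (m + 1))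

/-- The last element `n` of `π^(m+1)(1, χ^(m+1)(a))`; the level-`m` expansion
of `a` is `a_{m+1}, …, a_n`. -/
def levelEnd (m a : ℕ) : ℕ := (piStr (m + 1) (chi (m + 1) a)).getLastD 0

/-- `V_m := {v ≥ 0 : C(T_{v+1}^(m+1)) ≤ m}`. -/
def Vset (m : ℕ) : Set ℕ := {v | curl (Tstr (m + 1) (v + 1)) ≤ m}

/-- `Q := {α ≥ 0 : C(T_{α+1}^(2)) = 1}`. -/
def Qset : Set ℕ := {a | curl (Tstr 2 (a + 1)) = 1}

/-- `R := {(a,b) : a ∈ Q, a < b, no suffix S of T_{a+1}^(2) with T_{a+1}^(2)·S = T_{b+1}^(2)}`. -/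
def Rset : Set (ℕ × ℕ) :=
  {p | p.1 ∈ Qset ∧ p.1 < p.2 ∧
    ¬∃ S : List ℕ, S <:+ Tstr 2 (p.1 + 1) ∧ Tstr 2 (p.1 + 1) ++ S = Tstr 2 (p.2 + 1)}

/-- The digit of `x` in base `b` at (1-indexed) position `i`, i.e. the coefficient
of `b^(i-1)`. -/
def digitAt (b x i : ℕ) : ℕ := (Nat.digits b x).getD (i - 1) 0

/-- `u` is the (1-indexed) position of the second nonzero base-`b` digit of `x`
(the first nonzero digit being at position `ord_b(x)+1`). -/
def IsSecondNonzero (b x u : ℕ) : Prop :=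
  ordb b x + 1 < u ∧ digitAt b x u ≠ 0 ∧
    ∀ i, ordb b x + 1 < i → i < u → digitAt b x i = 0

/-- `𝒮_b`: pairs `(a,a')` with `1 ≤ a < a'` such that for some position `y` the
base-`b` digits of `a` and `a'` agree away from `y` and twice the `y`-th digit of `a`
is at least the `y`-th digit of `a'`. -/
def Sset (b : ℕ) : Set (ℕ × ℕ) :=
  {p | 1 ≤ p.1 ∧ p.1 < p.2 ∧
    ∃ y : ℕ, (∀ i, i ≠ y → (Nat.digits b p.1).getD i 0 = (Nat.digits b p.2).getD i 0) ∧
      (Nat.digits b p.2).getD y 0 ≤ 2 * (Nat.digits b p.1).getD y 0}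

/-- The glue string `S_t^(m)`, so that `T_{t+1}^(m) = T_t^(m) ++ glue m t`. -/
def glue (m t : ℕ) : List ℕ := (gPrefix (m + 1) (tau m (t + 1))).drop (tau m t)

/-- The strings `P_t^(m)`: `P_1^(m) = (m)` and `P_{t+1}^(m) = P_t^(m)·B_t^(m)·S_t^(m)`. -/
def Pstr (m : ℕ) : ℕ → List ℕ
  | 0 => []
  | 1 => [m]
  | t + 2 => Pstr m (t + 1) ++ Bstr m (t + 1) ++ glue m (t + 1)

end

/-- The string `s 0 · m · s 1 · m ⋯ m · s x`. -/
def joinGaps (m : ℕ) (s : ℕ → List ℕ) : ℕ → List ℕ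
  | 0 => s 0
  | x + 1 => joinGaps m s x ++ m :: s (x + 1)

lemma joinGaps_congr {m : ℕ} {s t : ℕ → List ℕ} {x : ℕ} (h : ∀ i ≤ x, s i = t i) :
    joinGaps m s x = joinGaps m t x := by
  induction x with
  | zero => simpa [joinGaps] using h 0 le_rfl
  | succ x ih =>
    simp only [joinGaps]
    rw [ih fun i hi => h i (by omega), h _ le_rfl]

lemma append_cons_inj_of_notMem {m : ℕ} {A B u v : List ℕ} (hu : m ∉ u) (hv : m ∉ v)
    (h : A ++ m :: u = B ++ m :: v) : A = B ∧ u = v := by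
  rcases List.append_eq_append_iff.1 h with ⟨c, hB, hc⟩ | ⟨c, hA, hc⟩
  · cases c with
    | nil => simp_all
    | cons a c =>
      simp only [List.cons_append, List.cons.injEq] at hc
      exact absurd (by rw [hc.2]; simp) hu
  · cases c with
    | nil => simp_all
    | cons a c =>
      simp only [List.cons_append, List.cons.injEq] at hc
      exact absurd (by rw [hc.2]; simp) hv

lemma count_joinGaps {m : ℕ} {s : ℕ → List ℕ} {x : ℕ} (hs : ∀ i ≤ x, m ∉ s i) :
    (joinGaps m s x).count m = x := by
  induction x with
  | zero => simpa [joinGaps] using List.count_eq_zero.2 (hs 0 le_rfl)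
  | succ x ih =>
    simp only [joinGaps, List.count_append, List.count_cons_self]
    rw [ih fun i hi => hs i (by omega), List.count_eq_zero.2 (hs _ le_rfl)]

lemma joinGaps_inj {m : ℕ} {s t : ℕ → List ℕ} {x : ℕ} (hs : ∀ i, m ∉ s i)
    (ht : ∀ i, m ∉ t i) (h : joinGaps m s x = joinGaps m t x) : ∀ i ≤ x, s i = t i := by
  induction x with
  | zero => intro i hi; obtain rfl : i = 0 := by omega
            exact h
  | succ x ih =>
    obtain ⟨h1, h2⟩ := append_cons_inj_of_notMem (hs _) (ht _) h
    intro i hi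
    rcases Nat.lt_or_ge x i with h3 | h3
    · obtain rfl : i = x + 1 := by omega
      exact h2
    · exact ih h1 i h3

lemma exists_eq_joinGaps (m : ℕ) (L : List ℕ) :
    ∃ s : ℕ → List ℕ, (∀ i, m ∉ s i) ∧ L = joinGaps m s (L.count m) := by
  induction L using List.reverseRecOn with
  | nil => exact ⟨fun _ => [], by simp, by simp [joinGaps]⟩
  | append_singleton L a ih =>
    obtain ⟨s, hs, hL⟩ := ih
    by_cases ha : a = m
    · subst ha
      refine ⟨Function.update s (L.count a + 1) [], fun i => ?_, ?_⟩
      · by_cases hi : i = L.count a + 1 <;> simp [hi, hs]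
      · rw [List.count_append, List.count_singleton_self, joinGaps, Function.update_self]
        congr 1
        conv_lhs => rw [hL]
        refine joinGaps_congr fun i hi => ?_
        rw [Function.update_of_ne (by omega)]
    · refine ⟨Function.update s (L.count m) (s (L.count m) ++ [a]), fun i => ?_, ?_⟩
      · by_cases hi : i = L.count m
        · simp [hi, hs, Ne.symm ha]
        · simp [hi, hs]
      · rw [List.count_append, List.count_singleton, if_neg (by simpa using ha), add_zero]
        conv_lhs => rw [hL]
        cases hc : L.count m with
        | zero => simp [joinGaps]
        | succ c =>
          simp only [joinGaps, Function.update_self, List.append_assoc, List.cons_append]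
          congr 1
          refine joinGaps_congr fun i hi => ?_
          rw [Function.update_of_ne (by omega)]

lemma joinGaps_append (m : ℕ) (s t : ℕ → List ℕ) (x y : ℕ) :
    joinGaps m s x ++ joinGaps m t y = joinGaps m
      (fun i => if i < x then s i else if i = x then s x ++ t 0 else t (i - x)) (x + y) := by
  induction y with
  | zero =>
    cases x with
    | zero => simp [joinGaps]
    | succ x =>
      simp only [joinGaps, lt_irrefl, if_false, if_true, List.append_assoc,
        List.cons_append]
      congr 1
      refine joinGaps_congr fun i hi => ?_
      rw [if_pos (by omega)]
  | succ y ih =>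
    rw [← add_assoc, joinGaps, joinGaps, ← ih, List.append_assoc, if_neg (by omega),
      if_neg (by omega), show x + y + 1 - x = y + 1 by omega]

lemma exists_joinGaps_append_pow {m p y k : ℕ} {ζ η : ℕ → List ℕ} (hζ : ∀ i, m ∉ ζ i)
    (hη : ∀ i, m ∉ η i) (hy : 0 < y) (hk : 1 ≤ k) :
    ∃ ξ : ℕ → List ℕ,
      joinGaps m ζ p ++ (List.replicate k (joinGaps m η y)).flatten
        = joinGaps m ξ (p + k * y) ∧
      (∀ i, m ∉ ξ i) ∧ ξ p = ζ p ++ η 0 ∧ ξ (p + k * y) = η y ∧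
      (∀ q, 1 ≤ q → q < k → ξ (p + q * y) = η y ++ η 0) ∧
      ∀ q < k, ∀ r, 1 ≤ r → r < y → ξ (p + q * y + r) = η r := by
  induction k, hk using Nat.le_induction with
  | base =>
    refine ⟨_, by simpa using joinGaps_append m ζ η p y, fun i => ?_, by simp, ?_, ?_, ?_⟩
    · split_ifs <;> simp [hζ, hη]
    · simp [hy.ne']
    · intro q h1 h2; omega
    · intro q hq r hr1 hr2
      obtain rfl : q = 0 := by omega
      simp only [zero_mul, add_zero]
      rw [if_neg (by omega), if_neg (by omega), Nat.add_sub_cancel_left]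
  | succ k hk ih =>
    obtain ⟨ξ, h1, h2, h3, h4, h5, h6⟩ := ih
    have hky : 0 < k * y := Nat.mul_pos hk hy
    have e1 : (k + 1) * y = k * y + y := by ring
    refine ⟨fun i => if i < p + k * y then ξ i else if i = p + k * y then
        ξ (p + k * y) ++ η 0 else η (i - (p + k * y)), ?_, ?_, ?_, ?_, ?_, ?_⟩
    · rw [List.replicate_succ', List.flatten_append, ← List.append_assoc, h1]
      simp only [List.flatten_cons, List.flatten_nil, List.append_nil]
      rw [joinGaps_append, e1, add_assoc]
    · intro i
      dsimp only
      split_ifs <;> simp [h2, hη]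
    · dsimp only
      rw [if_pos (by omega), h3]
    · dsimp only
      rw [if_neg (by omega), if_neg (by omega)]
      congr 1; omega
    · intro q hq1 hq2
      dsimp only
      rcases Nat.lt_or_ge q k with hq | hq
      · have : q * y < k * y := Nat.mul_lt_mul_of_pos_right hq hy
        rw [if_pos (by omega), h5 q hq1 hq]
      · obtain rfl : q = k := by omega
        rw [if_neg (by omega), if_pos rfl, h4]
    · intro q hq r hr1 hr2
      dsimp only
      rcases Nat.lt_or_ge q k with hq | hq
      · have : q * y + y ≤ k * y := by
          have := Nat.mul_le_mul_right y (show q + 1 ≤ k from hq)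
          linarith
        rw [if_pos (by omega), h6 q hq r hr1 hr2]
      · obtain rfl : q = k := by omega
        rw [if_neg (by omega), if_neg (by omega)]
        congr 1; omega

/-- A power `Y ^ k` at the end of a string forces periodicity of the gaps between the
occurrences of a letter `m` of `Y`. -/
lemma exists_gap_period {m x k : ℕ} {s : ℕ → List ℕ} {Y : List ℕ} (hs : ∀ i, m ∉ s i)
    (hk : 1 ≤ k) (hY : m ∈ Y) (h : (List.replicate k Y).flatten <:+ joinGaps m s x) :
    k * Y.count m ≤ x ∧ ∃ e : List ℕ, e <:+ s (x - k * Y.count m) ∧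
      (∀ i, 1 ≤ i → i < k → s (x - i * Y.count m) = s x ++ e) ∧
      ∀ i j, 1 ≤ i → i < Y.count m → j < k → s (x - (i + j * Y.count m)) = s (x - i) := by
  obtain ⟨P, hP⟩ := h
  have hy : 0 < Y.count m := List.count_pos_iff.2 hY
  obtain ⟨ζ, hζ, hPζ⟩ := exists_eq_joinGaps m P
  obtain ⟨η, hη, hYη⟩ := exists_eq_joinGaps m Y
  obtain ⟨ξ, h1, h2, h3, h4, h5, h6⟩ :=
    exists_joinGaps_append_pow (p := P.count m) hζ hη hy hk
  rw [← hPζ, ← hYη, hP] at h1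
  have hx : x = P.count m + k * Y.count m := by
    have := congrArg (List.count m) h1
    rwa [count_joinGaps fun i _ => hs i, count_joinGaps fun i _ => h2 i] at this
  rw [← hx] at h1
  have hsξ := joinGaps_inj hs h2 h1
  generalize Y.count m = y at *
  generalize P.count m = p at *
  refine ⟨by omega, η 0, ?_, ?_, ?_⟩
  · rw [hsξ _ (by omega), show x - k * y = p by omega, h3]
    exact List.suffix_append _ _
  · intro i hi1 hi2
    have e1 : (k - i) * y + i * y = k * y := by rw [← add_mul]; congr 1; omega
    rw [hsξ _ (by omega), hsξ x le_rfl, show x - i * y = p + (k - i) * y by omega,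
      h5 _ (by omega) (by omega), hx, h4]
  · have key : ∀ i j, 1 ≤ i → i < y → j < k → s (x - (i + j * y)) = η (y - i) := by
      intro i j hi1 hi2 hj
      have e1 : (k - 1 - j) * y + j * y + y = k * y := by
        rw [← add_mul, ← Nat.succ_mul]; congr 1; omega
      rw [hsξ _ (by omega), show x - (i + j * y) = p + (k - 1 - j) * y + (y - i) by omega,
        h6 _ (by omega) _ (by omega) (by omega)]
    intro i j hi1 hi2 hj
    rw [key i j hi1 hi2 hj]
    simpa using (key i 0 hi1 hi2 (by omega)).symm

/-- Conversely, periodic gaps produce a power at the end of the string. -/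
lemma exists_pow_suffix_joinGaps {m x k y : ℕ} {s : ℕ → List ℕ} (hy : 0 < y)
    (hk : k * y ≤ x) (h : ∀ i, x - k * y < i → i + y ≤ x → s (i + y) = s i) :
    ∃ Y : List ℕ, Y ≠ [] ∧ (List.replicate k Y).flatten <:+ joinGaps m s x := by
  have hadd : ∀ (s' : ℕ → List ℕ) (a c : ℕ), joinGaps m s' (a + c) =
      joinGaps m s' a ++ joinGaps m (fun i => if i = 0 then [] else s' (a + i)) c := by
    intro s' a c
    induction c with
    | zero => simp [joinGaps]
    | succ c ih => rw [← add_assoc, joinGaps, ih, joinGaps]; simp [add_assoc]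
  set Y := joinGaps m (fun i => if i = 0 then [] else s (x - y + i)) y with hY
  refine ⟨Y, ?_, ?_⟩
  · obtain ⟨y, rfl⟩ : ∃ y', y = y' + 1 := ⟨y - 1, by omega⟩
    simp [hY, joinGaps]
  · suffices ∀ j ≤ k, joinGaps m s x = joinGaps m s (x - j * y) ++
        (List.replicate j Y).flatten from ⟨_, (this k le_rfl).symm⟩
    intro j hj
    induction j with
    | zero => simp
    | succ j ih =>
      have e0 : (j + 1) * y ≤ k * y := Nat.mul_le_mul_right y hj
      have e1 : (j + 1) * y = j * y + y := by ring
      rw [ih (by omega), List.replicate_succ, List.flatten_cons, ← List.append_assoc]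
      congr 1
      rw [show x - j * y = (x - (j + 1) * y) + y by omega, hadd]
      congr 1
      refine joinGaps_congr fun i hi => ?_
      split_ifs with hi0
      · rfl
      · have : ∀ l ≤ j, s (x - (j + 1) * y + i + l * y) = s (x - (j + 1) * y + i) := by
          intro l hl
          induction l with
          | zero => simp
          | succ l ihl =>
            have e2 : (l + 1) * y ≤ j * y := Nat.mul_le_mul_right y hl
            have e3 : (l + 1) * y = l * y + y := by ring
            rw [e3, ← add_assoc, h _ (by omega) (by omega), ihl (by omega)]
        rw [← this j le_rfl]
        congr 1
        omega

lemma pow_dvd_iff_le_mult {b x i : ℕ} (hb : 2 ≤ b) (hx : 1 ≤ x) :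
    b ^ i ∣ x ↔ i ≤ multiplicity b x :=
  (Nat.finiteMultiplicity_iff.2 ⟨by omega, hx⟩).pow_dvd_iff_le_multiplicity

lemma mult_eq_of {b x v : ℕ} (hb : 2 ≤ b) (hx : 1 ≤ x) (h1 : b ^ v ∣ x)
    (h2 : ¬b ^ (v + 1) ∣ x) : multiplicity b x = v := by
  rw [pow_dvd_iff_le_mult hb hx] at h1 h2
  omega

/-- The `b`-adic valuation is not `y`-periodic on an interval of length at least `2 * y`
containing a multiple of `b ^ (v_b(y) + 1)`. -/
lemma mult_not_periodic {b y lo hi u : ℕ} (hb : 2 ≤ b) (hy : 1 ≤ y) (hlo : 1 ≤ lo)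
    (hlen : lo + 2 * y ≤ hi + 1) (hu : b ^ (multiplicity b y + 1) ∣ u) (hu1 : lo ≤ u)
    (hu2 : u ≤ hi)
    (h : ∀ i, lo ≤ i → i + y ≤ hi → multiplicity b i = multiplicity b (i + y)) : False := by
  have hny : ¬b ^ (multiplicity b y + 1) ∣ y := by
    rw [pow_dvd_iff_le_mult hb hy]; omega
  rcases Nat.lt_or_ge hi (u + y) with h1 | h1
  · have h2 := h (u - y) (by omega) (by omega)
    rw [Nat.sub_add_cancel (by omega)] at h2
    rw [pow_dvd_iff_le_mult hb (by omega), ← h2, ← pow_dvd_iff_le_mult hb (by omega)] at hu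
    have hu' : b ^ (multiplicity b y + 1) ∣ u := by
      rw [pow_dvd_iff_le_mult hb (by omega)] at hu ⊢
      omega
    exact hny ((Nat.dvd_add_right hu).1 (by rwa [Nat.sub_add_cancel (by omega)]))
  · have h2 := h u hu1 h1
    have hu' : b ^ (multiplicity b y + 1) ∣ u + y := by
      rw [pow_dvd_iff_le_mult hb (by omega)] at hu ⊢
      omega
    exact hny ((Nat.dvd_add_right hu).1 hu')

/-- The gap sequence `i ↦ T (v_b(i))`, with an empty string at `0`. -/
noncomputable def rulerGap (b : ℕ) (T : ℕ → List ℕ) (i : ℕ) : List ℕ :=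
  if i = 0 then [] else T (multiplicity b i)

lemma rulerGap_of_pos (b : ℕ) (T : ℕ → List ℕ) {i : ℕ} (hi : 1 ≤ i) :
    rulerGap b T i = T (multiplicity b i) := if_neg (by omega)

lemma notMem_rulerGap {m b : ℕ} {T : ℕ → List ℕ} (hT : ∀ v, m ∉ T v) (i : ℕ) :
    m ∉ rulerGap b T i := by
  unfold rulerGap; split_ifs <;> simp [hT]

lemma rulerGap_congr {b i j : ℕ} (T : ℕ → List ℕ) (hi : 1 ≤ i) (hj : 1 ≤ j)
    (h : multiplicity b i = multiplicity b j) : rulerGap b T i = rulerGap b T j := by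
  rw [rulerGap_of_pos b T hi, rulerGap_of_pos b T hj, h]

lemma mult_eq_of_rulerGap_eq {b i j : ℕ} {T : ℕ → List ℕ}
    (hT : StrictMono fun v => (T v).length) (hi : 1 ≤ i) (hj : 1 ≤ j)
    (h : rulerGap b T i = rulerGap b T j) : multiplicity b i = multiplicity b j := by
  rw [rulerGap_of_pos b T hi, rulerGap_of_pos b T hj] at h
  exact hT.injective (congrArg List.length h)

/-- Analysis of powers `Y ^ k`, with `m ∈ Y`, at the end of a ruler-type string. -/
lemma pow_suffix_ruler {m b k x : ℕ} {T : ℕ → List ℕ} {Y : List ℕ} (hb : 2 ≤ b)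
    (hmT : ∀ v, m ∉ T v) (hT : StrictMono fun v => (T v).length) (hk : 2 ≤ k) (hx : 1 ≤ x)
    (hdig : ∀ p, x / b ^ p % b < k) (hY : m ∈ Y)
    (h : (List.replicate k Y).flatten <:+ joinGaps m (rulerGap b T) x) :
    k = 2 ∧ Y.count m = b ^ multiplicity b x ∧ 2 * b ^ multiplicity b x < x ∧
      ∃ e : List ℕ, e ≠ [] ∧
        T (multiplicity b (x - b ^ multiplicity b x)) = T (multiplicity b x) ++ e ∧
        e <:+ T (multiplicity b x) := by
  have hy : 1 ≤ Y.count m := List.count_pos_iff.2 hY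
  obtain ⟨hkx, e, he, h1, h2⟩ := exists_gap_period (notMem_rulerGap hmT) (by omega) hY h
  generalize Y.count m = y at *
  have h2y : 2 * y ≤ k * y := Nat.mul_le_mul_right y hk
  by_cases hee : e = []
  · exfalso
    subst hee
    simp only [List.append_nil] at h1
    have hcls : ∀ d, d < k * y → rulerGap b T (x - d) = rulerGap b T (x - d % y) := by
      intro d hd
      have hdy : d / y < k := Nat.div_lt_of_lt_mul (by rwa [mul_comm])
      have hdd := Nat.mod_add_div' d y
      rcases Nat.eq_zero_or_pos (d % y) with h0 | h0
      · rw [h0, Nat.sub_zero]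
        rcases Nat.eq_zero_or_pos (d / y) with h3 | h3
        · rw [show d = 0 by rw [← hdd, h0, h3]; simp]; simp
        · rw [← h1 _ h3 hdy]; congr 1; omega
      · rw [← h2 _ _ h0 (Nat.mod_lt _ hy) hdy, hdd]
    set p := multiplicity b y with hp
    have hpy : b ^ p ≤ y := Nat.le_of_dvd hy ((pow_dvd_iff_le_mult hb hy).2 le_rfl)
    have hmodlt : x % b ^ (p + 1) < k * y := by
      by_contra hcon
      push Not at hcon
      have h3 := hdig p
      rw [← Nat.mod_mul_right_div_self, ← pow_succ] at h3
      have h4 : k * b ^ p ≤ x % b ^ (p + 1) := (Nat.mul_le_mul_left k hpy).trans hcon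
      have h5 := (Nat.le_div_iff_mul_le (Nat.pow_pos (by omega))).2 h4
      omega
    refine mult_not_periodic (lo := x - k * y + 1) (hi := x) (u := x - x % b ^ (p + 1)) hb hy
      (by omega) (by omega) (Nat.dvd_sub_mod x) (by omega) (Nat.sub_le _ _) fun i hi1 hi2 => ?_
    refine mult_eq_of_rulerGap_eq hT (by omega) (by omega) ?_
    have a1 := hcls (x - i) (by omega)
    have a2 := hcls (x - (i + y)) (by omega)
    rw [show x - i = x - (i + y) + y by omega, Nat.add_mod_right,
      show x - (x - (i + y) + y) = i by omega] at a1
    rw [show x - (x - (i + y)) = i + y by omega] at a2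
    rw [a1, a2]
  · have h1y := h1 1 le_rfl (by omega)
    rw [one_mul, rulerGap_of_pos b T (by omega), rulerGap_of_pos b T hx] at h1y
    set v := multiplicity b x with hv
    have hbv : 0 < b ^ v := Nat.pow_pos (by omega)
    have hvj : v < multiplicity b (x - y) := by
      have := congrArg List.length h1y
      have he' := List.length_pos_iff.2 hee
      rw [List.length_append] at this
      exact hT.lt_iff_lt.1 (by omega)
    have hd1 : b ^ (v + 1) ∣ x - y := (pow_dvd_iff_le_mult hb (by omega)).2 hvj
    have hdx : b ^ v ∣ x := (pow_dvd_iff_le_mult hb hx).2 le_rfl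
    have hndx : ¬b ^ (v + 1) ∣ x := by rw [pow_dvd_iff_le_mult hb hx]; omega
    have hndy : ¬b ^ (v + 1) ∣ y := fun h' => hndx (by
      have := Nat.dvd_add hd1 h'
      rwa [Nat.sub_add_cancel (by omega)] at this)
    have hdy : b ^ v ∣ y := by
      have := (Nat.dvd_add_right ((pow_dvd_pow b (Nat.le_succ v)).trans hd1)).1
        (show b ^ v ∣ x - y + y by rwa [Nat.sub_add_cancel (by omega)])
      exact this
    have hdvd_step : ∀ z, y ≤ z → b ^ (v + 1) ∣ z → ¬b ^ (v + 1) ∣ z - y := fun z hz h3 h4 =>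
      hndy ((Nat.dvd_add_right h4).1 (by rwa [Nat.sub_add_cancel hz]))
    have hk2 : k = 2 := by
      by_contra hk2
      have h3y : 3 * y ≤ k * y := Nat.mul_le_mul_right y (by omega)
      have h2y' := h1 2 (by omega) (by omega)
      rw [rulerGap_of_pos b T (by omega), rulerGap_of_pos b T hx, ← hv, ← h1y] at h2y'
      have h4 := hT.injective (congrArg List.length h2y')
      refine hdvd_step (x - y) (by omega) hd1 ?_
      rw [show x - y - y = x - 2 * y by omega, pow_dvd_iff_le_mult hb (by omega), h4]
      exact hvj
    subst hk2
    have hxmod : x % b ^ (v + 1) = b ^ v := by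
      have h3 := hdig v
      have h4 : x / b ^ v % b ≠ 0 := by
        intro h0
        refine hndx (Nat.dvd_of_mod_eq_zero ?_)
        rw [Nat.mod_pow_succ, h0, Nat.mod_eq_zero_of_dvd hdx]; simp
      rw [Nat.mod_pow_succ, Nat.mod_eq_zero_of_dvd hdx, show x / b ^ v % b = 1 by omega]
      simp
    have hyv : y = b ^ v := by
      by_contra hne
      have hlt : b ^ v < y := lt_of_le_of_ne (Nat.le_of_dvd hy hdy) (Ne.symm hne)
      have h3 := mult_eq_of_rulerGap_eq hT (by omega) (by omega)
        (h2 (b ^ v) 1 hbv hlt (by omega))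
      have h4 : b ^ (v + 1) ∣ x - b ^ v := hxmod ▸ Nat.dvd_sub_mod x
      refine hdvd_step _ (by omega) h4 ?_
      rw [show x - b ^ v - y = x - (b ^ v + 1 * y) by omega, pow_dvd_iff_le_mult hb (by omega), h3,
        ← pow_dvd_iff_le_mult hb (by omega)]
      exact h4
    have hx2 : 2 * y < x := by
      by_contra hcon
      rw [show x - 2 * y = 0 by omega] at he
      exact hee (by simpa [rulerGap] using he)
    refine ⟨rfl, hyv, by omega, e, hee, by rw [← hyv]; exact h1y, ?_⟩
    rw [rulerGap_of_pos b T (by omega)] at he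
    convert he using 2
    refine (mult_eq_of hb (by omega) (Nat.dvd_sub hdx (hdy.mul_left 2)) ?_).symm
    rw [show x - 2 * y = x - y - y by omega]
    exact hdvd_step _ (by omega) hd1

lemma length_flatten_replicate {α : Type*} (k : ℕ) (Y : List α) :
    (List.replicate k Y).flatten.length = k * Y.length := by
  simp

lemma bddAbove_curl_set (S : List ℕ) :
    BddAbove {k | ∃ X Y : List ℕ, Y ≠ [] ∧ S = X ++ (List.replicate k Y).flatten} := by
  refine ⟨S.length, ?_⟩
  rintro k ⟨X, Y, hY, rfl⟩
  have := List.length_pos_iff.2 hY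
  rw [List.length_append, length_flatten_replicate]
  nlinarith

lemma one_le_curl (S : List ℕ) : 1 ≤ curl S := le_max_left _ _

lemma le_curl_iff {S : List ℕ} {k : ℕ} (hk : 2 ≤ k) :
    k ≤ curl S ↔ ∃ Y : List ℕ, Y ≠ [] ∧ (List.replicate k Y).flatten <:+ S := by
  constructor
  · intro h
    unfold curl at h
    have h' := (le_max_iff.1 h).resolve_left (by omega)
    obtain ⟨X, Y, hY, hS⟩ := Nat.sSup_mem
      (s := {k | ∃ X Y : List ℕ, Y ≠ [] ∧ S = X ++ (List.replicate k Y).flatten})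
      ⟨0, S, [0], by simp, by simp⟩ (bddAbove_curl_set S)
    obtain ⟨d, hd⟩ := Nat.exists_eq_add_of_le' h'
    refine ⟨Y, hY, X ++ (List.replicate d Y).flatten, ?_⟩
    rw [List.append_assoc, ← List.flatten_append, ← List.replicate_add, ← hd]
    exact hS.symm
  · rintro ⟨Y, hY, X, hX⟩
    exact le_max_of_le_right (le_csSup (bddAbove_curl_set S) ⟨X, Y, hY, hX.symm⟩)

lemma curl_mono_suffix {S S' : List ℕ} (h : S <:+ S') : curl S ≤ curl S' := by
  rcases Nat.lt_or_ge (curl S) 2 with h1 | h1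
  · have := one_le_curl S'; omega
  · obtain ⟨Y, hY, hs⟩ := (le_curl_iff h1).1 le_rfl
    exact (le_curl_iff h1).2 ⟨Y, hY, hs.trans h⟩

lemma curl_nil : curl [] = 1 := by
  refine le_antisymm ?_ (one_le_curl _)
  by_contra h
  obtain ⟨Y, hY, hs⟩ := (le_curl_iff (k := 2) le_rfl).1 (by omega : 2 ≤ curl [])
  simp_all

lemma suffix_of_notMem {m : ℕ} {Z A t : List ℕ} (hZ : m ∉ Z) (h : Z <:+ A ++ m :: t) :
    Z <:+ t := by
  rcases List.suffix_or_suffix_of_suffix h (List.suffix_append A (m :: t)) with h1 | h1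
  · rcases List.suffix_cons_iff.1 h1 with h2 | h2
    · exact absurd (by rw [h2]; simp) hZ
    · exact h2
  · exact absurd (h1.subset (by simp)) hZ

lemma notMem_flatten_replicate {m k : ℕ} {Y : List ℕ} (h : m ∉ Y) :
    m ∉ (List.replicate k Y).flatten := by
  simp only [List.mem_flatten, List.mem_replicate, not_exists, not_and, and_imp]
  rintro _ _ rfl
  exact h

lemma length_gPrefix (m n : ℕ) : (gPrefix m n).length = n := by
  induction n with
  | zero => rfl
  | succ n ih => simp [gPrefix, ih]

lemma gPrefix_prefix {m l n : ℕ} (h : l ≤ n) : gPrefix m l <+: gPrefix m n := by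
  induction n, h using Nat.le_induction with
  | base => exact List.prefix_refl _
  | succ n _ ih => exact ih.trans (List.prefix_append _ _)

lemma le_of_mem_gPrefix {m n a : ℕ} (h : a ∈ gPrefix m n) : m ≤ a := by
  induction n with
  | zero => simp [gPrefix] at h
  | succ n ih =>
    simp only [gPrefix, List.mem_append, List.mem_singleton] at h
    rcases h with h | h
    · exact ih h
    · omega

section Structure

variable {m : ℕ}

lemma length_Tstr (m v : ℕ) : (Tstr m v).length = tau m v := length_gPrefix _ _

lemma notMem_Tstr (m v : ℕ) : m ∉ Tstr m v := fun h => by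
  have := le_of_mem_gPrefix h; omega

lemma strictMono_length_Tstr (hinf : {k : ℕ | curl (gPrefix (m + 1) k) ≤ m}.Infinite) :
    StrictMono fun v => (Tstr m (v + 1)).length := by
  simp only [length_Tstr]
  exact Nat.nth_strictMono hinf

lemma curl_Tstr_le (hinf : {k : ℕ | curl (gPrefix (m + 1) k) ≤ m}.Infinite) (v : ℕ) :
    curl (Tstr m (v + 1)) ≤ m :=
  Nat.nth_mem_of_infinite hinf v

lemma exists_tau_eq (hinf : {k : ℕ | curl (gPrefix (m + 1) k) ≤ m}.Infinite) {l : ℕ}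
    (hl : curl (gPrefix (m + 1) l) ≤ m) : ∃ v, tau m (v + 1) = l := by
  have : l ∈ Set.range (Nat.nth fun k => curl (gPrefix (m + 1) k) ≤ m) := by
    rw [Nat.range_nth_of_infinite hinf]; exact hl
  exact this

/-- The prefix of the level-`m` sequence consisting of the first `x` letters `m` and the gaps
following them. -/
noncomputable def gijBlock (m x : ℕ) : List ℕ :=
  joinGaps m (rulerGap (m + 1) fun v => Tstr m (v + 1)) x

lemma gijBlock_succ (m x : ℕ) :
    gijBlock m (x + 1) = gijBlock m x ++ m :: Tstr m (multiplicity (m + 1) (x + 1) + 1) := by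
  rw [gijBlock, joinGaps, rulerGap_of_pos _ _ (by omega)]; rfl

lemma count_gijBlock (m x : ℕ) : (gijBlock m x).count m = x :=
  count_joinGaps fun _ _ => notMem_rulerGap (fun v => notMem_Tstr m (v + 1)) _

lemma mult_add_eq {b u i z : ℕ} (hb : 2 ≤ b) (hi : 1 ≤ i) (hz : b ^ u ∣ z)
    (h1 : ¬b ^ (u + 1) ∣ i) (h2 : ¬b ^ (u + 1) ∣ i + z) :
    multiplicity b (i + z) = multiplicity b i := by
  have key : ∀ q, q ≤ multiplicity b (i + z) ↔ q ≤ multiplicity b i := by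
    intro q
    rw [← pow_dvd_iff_le_mult hb hi, ← pow_dvd_iff_le_mult hb (by omega)]
    rcases Nat.lt_or_ge u q with hq | hq
    · exact ⟨fun h => absurd ((pow_dvd_pow b hq).trans h) h2,
        fun h => absurd ((pow_dvd_pow b hq).trans h) h1⟩
    · exact (Nat.dvd_add_iff_left ((pow_dvd_pow b hq).trans hz)).symm
  exact le_antisymm ((key _).1 le_rfl) ((key _).2 le_rfl)

lemma not_dvd_of_between {N X i : ℕ} (hX : N ∣ X) (h1 : i < X) (h2 : X < i + N) : ¬N ∣ i :=
  fun h => by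
    have := Nat.le_of_dvd (by omega) (Nat.dvd_sub hX h)
    omega

lemma curl_gijBlock_le (hm : 1 ≤ m) (hinf : {k : ℕ | curl (gPrefix (m + 1) k) ≤ m}.Infinite)
    (x : ℕ) : curl (gijBlock m x) ≤ m := by
  cases x with
  | zero => rw [show gijBlock m 0 = [] by simp [gijBlock, joinGaps, rulerGap], curl_nil]; exact hm
  | succ x =>
  by_contra hcon
  obtain ⟨Y, hY, hs⟩ := (le_curl_iff (show 2 ≤ m + 1 by omega)).1 (Nat.lt_of_not_le hcon)
  by_cases hmY : m ∈ Y
  · obtain ⟨h1, -, -, e, he, h2, h3⟩ := pow_suffix_ruler (b := m + 1) (k := m + 1) (x := x + 1) (by omega)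
      (fun v => notMem_Tstr m (v + 1)) (strictMono_length_Tstr hinf) (by omega) (by omega)
      (fun p => Nat.mod_lt _ (by omega)) hmY hs
    obtain ⟨f, hf⟩ := h3
    have h4 := curl_Tstr_le hinf (multiplicity (m + 1) (x + 1 - (m + 1) ^
      multiplicity (m + 1) (x + 1)))
    have h5 : 2 ≤ curl (Tstr m (multiplicity (m + 1) (x + 1 - (m + 1) ^
      multiplicity (m + 1) (x + 1)) + 1)) := by
      refine (le_curl_iff le_rfl).2 ⟨e, he, f, ?_⟩
      rw [h2, ← hf]
      simp [List.replicate]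
    omega
  · rw [gijBlock_succ] at hs
    have h1 := suffix_of_notMem (notMem_flatten_replicate hmY) hs
    have h2 := (le_curl_iff (show 2 ≤ m + 1 by omega)).2 ⟨Y, hY, h1⟩
    have h3 := curl_Tstr_le hinf (multiplicity (m + 1) (x + 1))
    omega

lemma curl_gijBlock_append (hm : 1 ≤ m)
    (hinf : {k : ℕ | curl (gPrefix (m + 1) k) ≤ m}.Infinite) {x l : ℕ}
    (hl : l < tau m (multiplicity (m + 1) (x + 1) + 1)) :
    curl (gijBlock m x ++ m :: gPrefix (m + 1) l) = max (m + 1) (curl (gPrefix (m + 1) l)) := by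
  set t := gPrefix (m + 1) l with ht
  have hmt : m ∉ t := fun h => by have := le_of_mem_gPrefix h; omega
  set g := rulerGap (m + 1) fun v => Tstr m (v + 1) with hg
  have hgm : ∀ i, m ∉ g i := notMem_rulerGap fun v => notMem_Tstr m (v + 1)
  set s := Function.update g (x + 1) t with hs
  have hsg : ∀ i ≤ x, s i = g i := fun i hi => by
    rw [hs, Function.update_of_ne (by omega)]
  have hsx : s (x + 1) = t := by rw [hs, Function.update_self]
  have hsm : ∀ i, m ∉ s i := by
    intro i
    by_cases hi : i = x + 1
    · rw [hi, hsx]; exact hmt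
    · rw [hs, Function.update_of_ne hi]; exact hgm i
  have hL : gijBlock m x ++ m :: t = joinGaps m s (x + 1) := by
    rw [joinGaps, hsx, joinGaps_congr hsg]; rfl
  apply le_antisymm
  · by_contra hcon
    push Not at hcon
    set k := max (m + 1) (curl t) + 1 with hk
    have hk1 : m + 2 ≤ k := by have := le_max_left (m + 1) (curl t); omega
    have hk2 : curl t < k := by have := le_max_right (m + 1) (curl t); omega
    obtain ⟨Y, hY, hYs⟩ := (le_curl_iff (show 2 ≤ k by omega)).1 hcon
    by_cases hmY : m ∈ Y
    · rw [hL] at hYs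
      have hy : 1 ≤ Y.count m := List.count_pos_iff.2 hmY
      obtain ⟨hkx, e, -, h1, h2⟩ := exists_gap_period hsm (by omega) hmY hYs
      rw [hsx] at h1
      generalize Y.count m = y at *
      have hky : (m + 2) * y ≤ k * y := Nat.mul_le_mul_right y hk1
      have hky' : (m + 2) * y = (m + 1) * y + y := by ring
      have h2y : 2 * y ≤ (m + 1) * y := Nat.mul_le_mul_right y (by omega)
      set p := multiplicity (m + 1) y with hp
      have hpy : (m + 1) ^ p ≤ y :=
        Nat.le_of_dvd hy ((pow_dvd_iff_le_mult (by omega) hy).2 le_rfl)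
      have hpp : (m + 1) ^ (p + 1) ≤ (m + 1) * y := by
        rw [pow_succ']; exact Nat.mul_le_mul_left _ hpy
      have hmod : x % (m + 1) ^ (p + 1) < (m + 1) ^ (p + 1) :=
        Nat.mod_lt _ (Nat.pow_pos (by omega))
      refine mult_not_periodic (lo := x + 1 - (m + 1) * y) (hi := x)
        (u := x - x % (m + 1) ^ (p + 1)) (by omega) hy (by omega) (by omega)
        (Nat.dvd_sub_mod x) (by omega) (Nat.sub_le _ _) fun i hi1 hi2 => ?_
      refine mult_eq_of_rulerGap_eq (strictMono_length_Tstr hinf) (by omega) (by omega) ?_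
      rw [← hg, ← hsg i (by omega), ← hsg (i + y) hi2]
      have hcls : ∀ d, 1 ≤ d → d ≤ (m + 1) * y →
          s (x + 1 - d) = if d % y = 0 then t ++ e else s (x + 1 - d % y) := by
        intro d hd1 hd2
        have hdd := Nat.mod_add_div' d y
        have hdy : d / y ≤ m + 1 := Nat.div_le_of_le_mul (by rwa [mul_comm])
        split_ifs with h0
        · have h3 : 1 ≤ d / y := by
            rcases Nat.eq_zero_or_pos (d / y) with h3 | h3
            · rw [h3, h0] at hdd; omega
            · exact h3
          rw [← h1 _ h3 (by omega)]; congr 1; omega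
        · rw [← h2 _ _ (by omega) (Nat.mod_lt _ hy) (show d / y < k by omega), hdd]
      have a1 := hcls (x + 1 - i) (by omega) (by omega)
      have a2 := hcls (x + 1 - (i + y)) (by omega) (by omega)
      rw [show x + 1 - i = x + 1 - (i + y) + y by omega, Nat.add_mod_right,
        show x + 1 - (x + 1 - (i + y) + y) = i by omega] at a1
      rw [show x + 1 - (x + 1 - (i + y)) = i + y by omega] at a2
      rw [a1, a2]
    · have h1 := suffix_of_notMem (notMem_flatten_replicate hmY) hYs
      have := (le_curl_iff (show 2 ≤ k by omega)).2 ⟨Y, hY, h1⟩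
      omega
  · have hct : curl t ≤ curl (gijBlock m x ++ m :: t) :=
      curl_mono_suffix ((List.suffix_cons m t).trans (List.suffix_append _ _))
    refine max_le ?_ hct
    rcases Nat.lt_or_ge m (curl t) with h1 | h1
    · omega
    obtain ⟨u, hu⟩ := exists_tau_eq hinf h1
    set b := m + 1 with hb
    set v := multiplicity b (x + 1) with hv
    have huv : u < v := by
      rw [← hu] at hl
      have := (strictMono_length_Tstr hinf).lt_iff_lt (a := u) (b := v)
      simp only [length_Tstr] at this
      exact this.1 hl
    have hdv : b ^ (u + 1) ∣ x + 1 := (pow_dvd_iff_le_mult (by omega) (by omega)).2 huv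
    have hle := Nat.le_of_dvd (by omega) hdv
    have hbu : 0 < b ^ u := Nat.pow_pos (by omega)
    have hbb : b ^ (u + 1) = b * b ^ u := pow_succ' b u
    have hb2 : 2 * b ^ u ≤ b * b ^ u := Nat.mul_le_mul_right _ (by omega)
    rw [hL, le_curl_iff (by omega)]
    refine exists_pow_suffix_joinGaps hbu (by omega) fun i hi1 hi2 => ?_
    have hi3 : x + 1 < i + b ^ (u + 1) := by
      rw [← hbb] at hi1
      revert hi1 hle
      generalize b ^ (u + 1) = N
      omega
    have hni : ¬b ^ (u + 1) ∣ i := not_dvd_of_between hdv (by omega) hi3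
    rcases Nat.lt_or_ge (i + b ^ u) (x + 1) with h3 | h3
    · rw [hsg _ (by omega), hsg _ (by omega)]
      refine rulerGap_congr _ (by omega) (by omega)
        (mult_add_eq (by omega) (by omega) dvd_rfl hni ?_)
      exact not_dvd_of_between hdv h3 (hi3.trans_le (by gcongr; exact Nat.le_add_right _ _))
    · have h4 : i + b ^ u = x + 1 := by omega
      rw [h4, hsx, hsg _ (by omega), hg, rulerGap_of_pos _ _ (by omega),
        mult_eq_of (v := u) (by omega) (by omega) ?_ hni, ht, ← hu]
      · rfl
      · have : b ^ u ∣ i + b ^ u := by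
          rw [h4]; exact (pow_dvd_pow b (Nat.le_succ u)).trans hdv
        exact (Nat.dvd_add_left dvd_rfl).1 this

lemma length_gijBlock_succ (m x : ℕ) : (gijBlock m (x + 1)).length =
    (gijBlock m x).length + 1 + tau m (multiplicity (m + 1) (x + 1) + 1) := by
  rw [gijBlock_succ, List.length_append, List.length_cons, length_Tstr]; omega

lemma strictMono_length_gijBlock (m : ℕ) : StrictMono fun x => (gijBlock m x).length :=
  strictMono_nat_of_lt_succ fun x => by rw [length_gijBlock_succ]; omega

lemma gPrefix_add_of_eq (hm : 1 ≤ m)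
    (hinf : {k : ℕ | curl (gPrefix (m + 1) k) ≤ m}.Infinite) {x : ℕ}
    (hx : gPrefix m (gijBlock m x).length = gijBlock m x) {l : ℕ}
    (hl : l ≤ tau m (multiplicity (m + 1) (x + 1) + 1)) :
    gPrefix m ((gijBlock m x).length + 1 + l) = gijBlock m x ++ m :: gPrefix (m + 1) l := by
  induction l with
  | zero =>
    change gPrefix m _ ++ [max m (curl (gPrefix m _))] = _
    rw [hx, max_eq_left (curl_gijBlock_le hm hinf x)]
    rfl
  | succ l ih =>
    rw [← add_assoc, gPrefix, ih (by omega), curl_gijBlock_append hm hinf (by omega),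
      gPrefix, List.append_assoc, List.cons_append]
    congr 4
    omega

/-- The structure theorem: the blocks are prefixes of the sequence. -/
lemma gPrefix_length_gijBlock (hm : 1 ≤ m)
    (hinf : {k : ℕ | curl (gPrefix (m + 1) k) ≤ m}.Infinite) (x : ℕ) :
    gPrefix m (gijBlock m x).length = gijBlock m x := by
  induction x with
  | zero => simp [gijBlock, joinGaps, rulerGap, gPrefix]
  | succ x ih =>
    rw [length_gijBlock_succ, gPrefix_add_of_eq hm hinf ih le_rfl, gijBlock_succ]
    rfl

lemma exists_eq_length_gijBlock (hm : 1 ≤ m)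
    (hinf : {k : ℕ | curl (gPrefix (m + 1) k) ≤ m}.Infinite) {L : ℕ}
    (hL : curl (gPrefix m L) ≤ m) : ∃ x, L = (gijBlock m x).length := by
  have hex : ∃ x, L < (gijBlock m x).length :=
    ⟨L + 1, by have := (strictMono_length_gijBlock m).le_apply (x := L + 1); omega⟩
  have h1 := Nat.find_spec hex
  have h2 : ∀ y < Nat.find hex, (gijBlock m y).length ≤ L := fun y hy =>
    Nat.le_of_not_lt (Nat.find_min hex hy)
  generalize Nat.find hex = x at h1 h2
  cases x with
  | zero => simp [gijBlock, joinGaps, rulerGap] at h1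
  | succ x =>
    have h3 := h2 x (by omega)
    rw [length_gijBlock_succ] at h1
    rcases h3.eq_or_lt with h4 | h4
    · exact ⟨x, h4.symm⟩
    · exfalso
      obtain ⟨l, rfl⟩ := Nat.exists_eq_add_of_le (Nat.succ_le_of_lt h4)
      rw [Nat.succ_eq_add_one, gPrefix_add_of_eq hm hinf (gPrefix_length_gijBlock hm hinf x)
        (by omega), curl_gijBlock_append hm hinf (by omega)] at hL
      have := le_max_left (m + 1) (curl (gPrefix (m + 1) l))
      omega

end Structure

lemma chi_zero (b : ℕ) : chi b 0 = 0 := by simp [chi]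

lemma chi_eq {b : ℕ} (hb : 2 ≤ b) (a : ℕ) : chi b a = a % b + (b + 1) * chi b (a / b) := by
  rcases Nat.eq_zero_or_pos a with rfl | ha
  · simp [chi_zero]
  · rw [chi, Nat.digits_def' (by omega) ha, Nat.ofDigits_cons, chi]

lemma digits_chi {b : ℕ} (hb : 2 ≤ b) (a : ℕ) : Nat.digits (b + 1) (chi b a) = Nat.digits b a :=
  Nat.digits_ofDigits _ (by omega) _
    (fun _ hl => (Nat.digits_lt_base (by omega) hl).trans (Nat.lt_succ_self b))
    fun h => Nat.getLast_digit_ne_zero b (Nat.digits_ne_nil_iff_ne_zero.1 h)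

lemma chi_strictMono {b : ℕ} (hb : 2 ≤ b) : StrictMono (chi b) := by
  intro a c
  induction c using Nat.strong_induction_on generalizing a with
  | _ c ih =>
    intro hac
    rw [chi_eq hb a, chi_eq hb c]
    have ha := Nat.mod_add_div a b
    have hc := Nat.mod_add_div c b
    have hma := Nat.mod_lt a (show b > 0 by omega)
    rcases (Nat.div_le_div_right (c := b) hac.le).eq_or_lt with h | h
    · rw [h] at ha ⊢
      omega
    · have := Nat.mul_le_mul_left (b + 1) (ih _ (Nat.div_lt_self (by omega) (by omega)) h)
      rw [Nat.mul_succ] at this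
      omega

lemma chi_div_mod_lt {b : ℕ} (hb : 2 ≤ b) (p a : ℕ) : chi b a / (b + 1) ^ p % (b + 1) < b := by
  induction p generalizing a with
  | zero =>
    rw [pow_zero, Nat.div_one, chi_eq hb, Nat.add_mul_mod_self_left]
    exact (Nat.mod_le _ _).trans_lt (Nat.mod_lt _ (by omega))
  | succ p ih =>
    have hma := Nat.mod_lt a (show b > 0 by omega)
    rw [pow_succ', ← Nat.div_div_eq_div_mul, chi_eq hb, Nat.add_mul_div_left _ _ (by omega),
      Nat.div_eq_of_lt (show a % b < b + 1 by omega), zero_add]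
    exact ih _

lemma exists_chi_eq {b : ℕ} (hb : 2 ≤ b) (x : ℕ) (hx : ∀ p, x / (b + 1) ^ p % (b + 1) < b) :
    ∃ a, chi b a = x := by
  induction x using Nat.strong_induction_on with
  | _ x ih =>
    rcases Nat.eq_zero_or_pos x with rfl | h0
    · exact ⟨0, chi_zero b⟩
    · obtain ⟨a, ha⟩ := ih (x / (b + 1)) (Nat.div_lt_self h0 (by omega)) fun p => by
        have := hx (p + 1)
        rwa [pow_succ', ← Nat.div_div_eq_div_mul] at this
      have h := hx 0
      rw [pow_zero, Nat.div_one] at h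
      refine ⟨x % (b + 1) + b * a, ?_⟩
      rw [chi_eq hb, Nat.add_mul_mod_self_left, Nat.mod_eq_of_lt h,
        Nat.add_mul_div_left _ _ (by omega), Nat.div_eq_of_lt h, zero_add, ha, Nat.mod_add_div]

lemma chi_add_pow_mul {b : ℕ} (hb : 2 ≤ b) (k : ℕ) : ∀ (r c : ℕ), r < b ^ k →
    chi b (r + b ^ k * c) = chi b r + (b + 1) ^ k * chi b c := by
  induction k with
  | zero => intro r c hr; obtain rfl : r = 0 := by simpa using hr
            simp [chi_zero]
  | succ k ih =>
    intro r c hr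
    rw [chi_eq hb (r + _), chi_eq hb r, pow_succ', mul_assoc, Nat.add_mul_mod_self_left,
      Nat.add_mul_div_left _ _ (by omega),
      ih _ _ (Nat.div_lt_of_lt_mul (by rwa [← pow_succ']))]
    ring

lemma chi_pow {b : ℕ} (hb : 2 ≤ b) (k : ℕ) : chi b (b ^ k) = (b + 1) ^ k := by
  have h1 : chi b 1 = 1 := by
    rw [chi_eq hb, Nat.mod_eq_of_lt (by omega), Nat.div_eq_of_lt (by omega), chi_zero,
      mul_zero, add_zero]
  have := chi_add_pow_mul hb k 0 1 (Nat.pow_pos (by omega))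
  simpa [chi_zero, h1] using this

lemma le_curl_gijBlock {m x p : ℕ} (hm : 2 ≤ m) (hp : m ≤ x / (m + 1) ^ p % (m + 1)) :
    m ≤ curl (gijBlock m x) := by
  obtain ⟨b, hb⟩ : ∃ b, b = m + 1 := ⟨_, rfl⟩
  rw [le_curl_iff hm, gijBlock]
  rw [← hb] at hp ⊢
  have hbp : 0 < b ^ p := Nat.pow_pos (by omega)
  have hx := Nat.mod_le x (b ^ (p + 1))
  have hmod : m * b ^ p ≤ x % b ^ (p + 1) := by
    rw [Nat.mod_pow_succ, mul_comm m]
    exact (Nat.mul_le_mul_left _ hp).trans (Nat.le_add_left _ _)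
  have hlt : x % b ^ (p + 1) < b ^ (p + 1) := Nat.mod_lt _ (Nat.pow_pos (by omega))
  have hnd : ∀ i, x - m * b ^ p < i → i ≤ x → ¬b ^ (p + 1) ∣ i := by
    intro i hi1 hi2 hd
    have h2 := Nat.le_of_dvd (by omega) (Nat.dvd_sub hd (Nat.dvd_sub_mod (n := b ^ (p + 1)) x))
    omega
  refine exists_pow_suffix_joinGaps hbp (by omega) fun i hi1 hi2 => ?_
  exact rulerGap_congr _ (by omega) (by omega)
    (mult_add_eq (by omega) (by omega) dvd_rfl (hnd i hi1 (by omega)) (hnd _ (by omega) hi2))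

lemma mult_add_pow_mul {b k i q : ℕ} (hb : 2 ≤ b) (hi : 1 ≤ i) (hi' : i < b ^ k) :
    multiplicity b (i + b ^ k * q) = multiplicity b i := by
  have h1 : ¬b ^ k ∣ i := fun h => by have := Nat.le_of_dvd hi h; omega
  refine mult_add_eq hb hi (dvd_mul_right _ _) (fun h => h1 ?_) fun h => h1 ?_
  · exact (pow_dvd_pow b (Nat.le_succ k)).trans h
  · exact (Nat.dvd_add_left (dvd_mul_right _ _)).1 ((pow_dvd_pow b (Nat.le_succ k)).trans h)

lemma gijBlock_suffix {m k q : ℕ} (hm : 1 ≤ m) {r : ℕ} (hr : r < (m + 1) ^ k) :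
    gijBlock m r <:+ gijBlock m (r + (m + 1) ^ k * q) := by
  suffices h : gijBlock m (r + (m + 1) ^ k * q) = gijBlock m ((m + 1) ^ k * q) ++ gijBlock m r from
    ⟨_, h.symm⟩
  induction r with
  | zero => simp [gijBlock, joinGaps, rulerGap]
  | succ r ih =>
    rw [add_right_comm, gijBlock_succ, gijBlock_succ, ih (by omega), List.append_assoc,
      add_right_comm, mult_add_pow_mul (by omega) (by omega) hr]

lemma Tstr_prefix {m u v : ℕ} (hinf : {k : ℕ | curl (gPrefix (m + 1) k) ≤ m}.Infinite)
    (h : u ≤ v) : Tstr m (u + 1) <+: Tstr m (v + 1) := by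
  refine gPrefix_prefix ?_
  have := (strictMono_length_Tstr hinf).monotone h
  simpa only [length_Tstr] using this

/-- `a` indexes a string `T_t^(j)`. -/
def IsGood (j a : ℕ) : Prop := curl (gijBlock (j + 1) (chi (j + 1) a)) ≤ j

lemma isGood_zero {j : ℕ} (hj : 1 ≤ j) : IsGood j 0 := by
  rw [IsGood, chi_zero, show gijBlock (j + 1) 0 = [] by simp [gijBlock, joinGaps, rulerGap],
    curl_nil]
  exact hj

lemma isGood_of_add {j k r c : ℕ} (hj : 1 ≤ j) (hr : r < (j + 1) ^ k)
    (h : IsGood j (r + (j + 1) ^ k * c)) : IsGood j r := by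
  rw [IsGood, chi_add_pow_mul (by omega) _ _ _ hr] at h
  refine (curl_mono_suffix (gijBlock_suffix (by omega) ?_)).trans h
  rw [← chi_pow (by omega)]
  exact chi_strictMono (by omega) hr

lemma isGood_add {j k n r c : ℕ} (hj : 1 ≤ j)
    (hinf : {l : ℕ | curl (gPrefix (j + 1 + 1) l) ≤ j + 1}.Infinite)
    (hn : n ∈ Tstr (j + 1) (k + 1)) (hn' : ∀ v < k, n ∉ Tstr (j + 1) (v + 1))
    (hr : r < (j + 1) ^ k) (hr0 : r ≠ 0) (h : IsGood j r) :
    IsGood j (r + (j + 1) ^ k * c) := by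
  obtain ⟨M, hM⟩ : ∃ M, M = j + 1 := ⟨_, rfl⟩
  have hρ : chi M r < (M + 1) ^ k := by
    rw [← chi_pow (by omega)]; exact chi_strictMono (by omega) (by rwa [hM])
  have hρ0 : 0 < chi M r := by
    rw [← chi_zero M]; exact chi_strictMono (by omega) (by omega)
  have hsuf := gijBlock_suffix (q := chi M c) (by omega) hρ
  have hdig := fun p => chi_div_mod_lt (b := M) (by omega) p (r + M ^ k * c)
  rw [chi_add_pow_mul (by omega) _ _ _ (by rwa [hM])] at hdig
  unfold IsGood at h ⊢
  rw [← hM] at h hn hn' hr hinf ⊢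
  rw [chi_add_pow_mul (by omega) _ _ _ hr]
  have hmult := mult_add_pow_mul (b := M + 1) (q := chi M c) (by omega) hρ0 hρ
  have hXdvd : (M + 1) ^ k ∣ (M + 1) ^ k * chi M c := dvd_mul_right _ _
  generalize hρr : chi M r = ρ at *
  generalize (M + 1) ^ k * chi M c = z at *
  by_contra! hcon
  obtain ⟨Y, hY, hYs⟩ := (le_curl_iff (k := M) (by omega)).1 (hM.trans_le hcon)
  rcases List.suffix_or_suffix_of_suffix hYs hsuf with hc | hc
  · have := (le_curl_iff (k := M) (by omega)).2 ⟨Y, hY, hc⟩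
    omega
  have hcount := hc.sublist.count_le M
  rw [count_gijBlock] at hcount
  have hmY : M ∈ Y := by
    by_contra hmY
    rw [List.count_eq_zero.2 (notMem_flatten_replicate hmY)] at hcount
    omega
  obtain ⟨h2, hcY, -, e, he, hTe, heT⟩ := pow_suffix_ruler (b := M + 1) (by omega)
    (fun v => notMem_Tstr M (v + 1)) (strictMono_length_Tstr hinf) (by omega) (by omega) hdig
    hmY hYs
  rw [hmult] at hcY hTe heT
  have hcount2 : (List.replicate M Y).flatten.count M = 2 * Y.count M := by
    rw [List.count_flatten, List.map_replicate, List.sum_replicate, smul_eq_mul]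
    congr 1
  rw [hcount2, hcY] at hcount
  set v := multiplicity (M + 1) ρ with hv
  have hvρ : (M + 1) ^ v ∣ ρ := (pow_dvd_iff_le_mult (by omega) (by omega)).2 le_rfl
  have hvle := Nat.le_of_dvd hρ0 hvρ
  have hvk : v < k := by
    by_contra hvk
    have := Nat.pow_le_pow_right (show 0 < M + 1 by omega) (Nat.le_of_not_lt hvk)
    omega
  set u := multiplicity (M + 1) (ρ + z - (M + 1) ^ v) with hu
  have hvu : v < u := by
    have h3 := congrArg List.length hTe
    have h4 := List.length_pos_iff.2 he
    rw [List.length_append] at h3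
    exact (strictMono_length_Tstr hinf).lt_iff_lt.1 (by omega)
  rcases Nat.lt_or_ge u k with huk | huk
  · have hsub : ρ + z - (M + 1) ^ v = (ρ - (M + 1) ^ v) + z := by omega
    by_cases h0 : ρ - (M + 1) ^ v = 0
    · rw [h0, zero_add] at hsub
      rcases Nat.eq_zero_or_pos z with hz | hz
      · rw [hz, add_zero] at hcon
        omega
      · rw [hsub] at hu
        have := (pow_dvd_iff_le_mult (b := M + 1) (by omega) hz).1 hXdvd
        omega
    · have h1 : (M + 1) ^ (v + 1) ∣ ρ + z - (M + 1) ^ v :=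
        (pow_dvd_iff_le_mult (by omega) (by omega)).2 hvu
      rw [hsub] at h1
      have h3 := Nat.le_of_dvd (by omega)
        ((Nat.dvd_add_left ((pow_dvd_pow (M + 1) hvk).trans hXdvd)).1 h1)
      have h4 : 2 * (M + 1) ^ v ≤ (M + 1) ^ v.succ := by
        rw [pow_succ']; exact Nat.mul_le_mul_right _ (by omega)
      have h5 : 0 < (M + 1) ^ v := Nat.pow_pos (by omega)
      omega
  · have h1 := (Tstr_prefix hinf huk).subset hn
    rw [hTe, List.mem_append] at h1
    exact hn' v hvk (h1.elim id fun h' => heT.subset h')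

lemma exists_isGood_pow_mul {j k : ℕ} (hj : 1 ≤ j)
    (hinf : {l : ℕ | curl (gPrefix (j + 1 + 1) l) ≤ j + 1}.Infinite)
    (hk : curl (Tstr (j + 1) (k + 1)) = 1) :
    ∃ L ≥ 1, ∀ c, c % (j + 1) ^ L = 1 → IsGood j ((j + 1) ^ k * c) := by
  obtain ⟨M, hM⟩ : ∃ M, M = j + 1 := ⟨_, rfl⟩
  unfold IsGood
  rw [← hM] at hk hinf ⊢
  refine ⟨2 * (Tstr M (k + 1)).length + 1, by omega, fun c hc => ?_⟩
  set L := 2 * (Tstr M (k + 1)).length + 1 with hL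
  have h1L : 1 < M ^ L := Nat.one_lt_pow (by omega) (by omega)
  have hdig := fun p => chi_div_mod_lt (b := M) (by omega) p (M ^ k * c)
  have h1 : chi M 1 = 1 := by simpa using chi_pow (b := M) (by omega) 0
  have hX : chi M (M ^ k * c) = (M + 1) ^ k + (M + 1) ^ (k + L) * chi M (c / M ^ L) := by
    have h2 := chi_add_pow_mul (b := M) (by omega) k 0 c (Nat.pow_pos (by omega))
    have h3 := chi_add_pow_mul (b := M) (by omega) L 1 (c / M ^ L) h1L
    rw [zero_add, chi_zero, zero_add] at h2
    rw [show 1 + M ^ L * (c / M ^ L) = c by rw [← hc, Nat.mod_add_div], h1] at h3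
    rw [h2, h3, pow_add]; ring
  rw [hX] at hdig ⊢
  generalize chi M (c / M ^ L) = q at *
  have hbk : 0 < (M + 1) ^ k := Nat.pow_pos (by omega)
  have hmult : multiplicity (M + 1) ((M + 1) ^ k + (M + 1) ^ (k + L) * q) = k := by
    rw [mult_add_pow_mul (by omega) hbk (Nat.pow_lt_pow_right (by omega) (by omega))]
    refine mult_eq_of (by omega) hbk dvd_rfl fun h => ?_
    have := (Nat.pow_dvd_pow_iff_le_right (show 1 < M + 1 by omega)).1 h
    omega
  by_contra! hcon
  obtain ⟨Y, hY, hYs⟩ := (le_curl_iff (k := M) (by omega)).1 (hM.trans_le hcon)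
  by_cases hmY : M ∈ Y
  · obtain ⟨-, -, h2x, e, he, hTe, heT⟩ := pow_suffix_ruler (b := M + 1) (by omega)
      (fun v => notMem_Tstr M (v + 1)) (strictMono_length_Tstr hinf) (by omega) (by omega) hdig
      hmY hYs
    rw [hmult] at h2x hTe heT
    rw [Nat.add_sub_cancel_left] at hTe
    have hz : 1 ≤ (M + 1) ^ (k + L) * q := by omega
    have h3 := (pow_dvd_iff_le_mult (b := M + 1) (by omega) hz).1 (dvd_mul_right _ _)
    have h4 := congrArg List.length hTe
    rw [List.length_append] at h4
    have h5 := heT.length_le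
    have h6 := (strictMono_length_Tstr hinf).le_apply
      (x := multiplicity (M + 1) ((M + 1) ^ (k + L) * q))
    omega
  · obtain ⟨x, hx⟩ : ∃ x, (M + 1) ^ k + (M + 1) ^ (k + L) * q = x + 1 :=
      ⟨_, (Nat.succ_pred_eq_of_pos (by omega)).symm⟩
    rw [hx] at hmult hYs
    rw [gijBlock_succ, hmult] at hYs
    have h3 := (le_curl_iff (k := M) (by omega)).2
      ⟨Y, hY, suffix_of_notMem (notMem_flatten_replicate hmY) hYs⟩
    omega

lemma tendsto_count_div {G : ℕ → Prop} (hG : {n | G n}.Infinite) {ν : ℝ}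
    (h : Tendsto (fun x : ℕ => ((x + 1 : ℕ) : ℝ) / (Nat.nth G x : ℝ)) atTop (nhds ν)) :
    Tendsto (fun n : ℕ => (Nat.count G n : ℝ) / n) atTop (nhds ν) := by
  have hk : Tendsto (Nat.count G) atTop atTop :=
    tendsto_atTop_atTop_of_monotone (Nat.count_monotone G) fun b =>
      ⟨Nat.nth G b, by rw [Nat.count_nth_of_infinite hG]⟩
  have hlow := (h.comp hk).sub (tendsto_one_div_atTop_nhds_zero_nat (𝕜 := ℝ))
  have hup := h.comp ((tendsto_sub_atTop_nat 1).comp hk)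
  rw [sub_zero] at hlow
  refine tendsto_of_tendsto_of_tendsto_of_le_of_le' hlow hup ?_ ?_
  · filter_upwards [eventually_gt_atTop 0] with n hn
    have h1 : (n : ℝ) ≤ Nat.nth G (Nat.count G n) := by
      exact_mod_cast Nat.le_nth_count hG n
    have h0 : (0 : ℝ) < n := by exact_mod_cast hn
    simp only [Function.comp_apply]
    rw [sub_le_iff_le_add, ← add_div]
    push_cast
    gcongr
  · filter_upwards [hk.eventually_ge_atTop 2] with n hn
    have h1 : Nat.nth G (Nat.count G n - 1) < n := Nat.nth_lt_of_lt_count (by omega)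
    have h2 : Nat.count G n - 1 ≤ Nat.nth G (Nat.count G n - 1) :=
      (Nat.nth_strictMono hG).le_apply
    have h3 : (0 : ℝ) < Nat.nth G (Nat.count G n - 1) := by
      have : 0 < Nat.nth G (Nat.count G n - 1) := by omega
      exact_mod_cast this
    have h4 : (Nat.nth G (Nat.count G n - 1) : ℝ) ≤ n := by exact_mod_cast h1.le
    simp only [Function.comp_apply]
    rw [Nat.sub_add_cancel (by omega)]
    gcongr

section Density

variable {G : ℕ → Prop} {N B : ℕ}

lemma count_mul_le (h1 : ∀ r c, r < N → G (r + N * c) → G r) (Q : ℕ) :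
    Nat.count G (N * Q) ≤ Q * Nat.count G N := by
  induction Q with
  | zero => simp
  | succ Q ih =>
    rw [Nat.mul_succ, Nat.count_add, Nat.succ_mul]
    refine Nat.add_le_add ih ?_
    rw [Nat.count_eq_card_filter_range, Nat.count_eq_card_filter_range]
    refine Finset.card_le_card fun r hr => ?_
    rw [Finset.mem_filter, Finset.mem_range] at hr ⊢
    exact ⟨hr.1, h1 r Q hr.1 (by rw [add_comm]; exact hr.2)⟩

lemma le_count_mul (hN : 1 ≤ N) (h0 : G 0)
    (h2 : ∀ r c, r < N → r ≠ 0 → G r → G (r + N * c))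
    (h3 : ∀ c, c % B = 1 → G (N * c)) (Q : ℕ) :
    Q * (Nat.count G N - 1) + Nat.count (fun c => c % B = 1) Q ≤ Nat.count G (N * Q) := by
  induction Q with
  | zero => simp
  | succ Q ih =>
    rw [Nat.mul_succ, Nat.count_add G, Nat.succ_mul, Nat.count_succ]
    suffices h : (Nat.count G N - 1) + (if Q % B = 1 then 1 else 0) ≤
        Nat.count (fun k => G (N * Q + k)) N by omega
    obtain ⟨N, rfl⟩ := Nat.exists_eq_add_of_le' hN
    rw [Nat.count_succ', Nat.count_succ']
    have hle : Nat.count (fun k => G (k + 1)) N ≤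
        Nat.count (fun k => G ((N + 1) * Q + (k + 1))) N := by
      rw [Nat.count_eq_card_filter_range, Nat.count_eq_card_filter_range]
      refine Finset.card_le_card fun r hr => ?_
      rw [Finset.mem_filter, Finset.mem_range] at hr ⊢
      exact ⟨hr.1, by rw [add_comm]; exact h2 _ _ (by omega) (by omega) hr.2⟩
    have hi : (if Q % B = 1 then 1 else 0) ≤ if G ((N + 1) * Q + 0) then 1 else 0 := by
      split_ifs with h4 h5
      · exact le_rfl
      · exact absurd (h3 Q h4) h5
      · exact Nat.zero_le _
      · exact le_rfl
    rw [if_pos h0]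
    omega

lemma count_eq_ceil (hN : 1 ≤ N) (hB : 2 ≤ B) (h0 : G 0)
    (h1 : ∀ r c, r < N → G (r + N * c) → G r)
    (h2 : ∀ r c, r < N → r ≠ 0 → G r → G (r + N * c))
    (h3 : ∀ c, c % B = 1 → G (N * c)) {ν : ℝ}
    (hν : Tendsto (fun n : ℕ => (Nat.count G n : ℝ) / n) atTop (nhds ν)) :
    Nat.count G N = ⌈ν * N⌉₊ := by
  have hc : 0 < Nat.count G N := by
    obtain ⟨N, rfl⟩ := Nat.exists_eq_add_of_le' hN
    rw [Nat.count_succ', if_pos h0]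
    omega
  have hN' : (0 : ℝ) < N := by exact_mod_cast hN
  have hB' : (0 : ℝ) < B := by exact_mod_cast (by omega : 0 < B)
  have hlim : Tendsto (fun R : ℕ => N * (B * (R + 1))) atTop atTop :=
    tendsto_atTop_mono (fun R => by
      calc R ≤ 1 * (1 * (R + 1)) := by omega
        _ ≤ _ := by gcongr; omega) tendsto_id
  have hν' := hν.comp hlim
  have hcount : ∀ R, R * 1 ≤ Nat.count (fun c => c % B = 1) (B * R) := by
    intro R
    induction R with
    | zero => simp
    | succ R ih =>
      rw [Nat.mul_succ B, Nat.count_add, Nat.succ_mul]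
      refine Nat.add_le_add ih ?_
      rw [Nat.one_le_iff_ne_zero, ← Nat.pos_iff_ne_zero, Nat.count_eq_card_filter_range,
        Finset.card_pos]
      exact ⟨1, by
        rw [Finset.mem_filter, Finset.mem_range, Nat.mul_add_mod]
        exact ⟨by omega, Nat.mod_eq_of_lt (by omega)⟩⟩
  have hup : ν * N ≤ Nat.count G N := by
    rw [← le_div_iff₀ hN']
    refine le_of_tendsto hν' (Eventually.of_forall fun R => ?_)
    simp only [Function.comp_apply]
    have h4 := count_mul_le h1 (B * (R + 1))
    have h5 : (Nat.count G (N * (B * (R + 1))) : ℝ) ≤ B * (R + 1) * Nat.count G N := by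
      exact_mod_cast h4
    rw [div_le_div_iff₀ (by positivity) hN']
    push_cast
    nlinarith
  have hlow : (Nat.count G N : ℝ) - 1 + 1 / B ≤ ν * N := by
    rw [← div_le_iff₀ hN']
    refine ge_of_tendsto hν' (Eventually.of_forall fun R => ?_)
    simp only [Function.comp_apply]
    have h4 := (Nat.add_le_add_left (hcount (R + 1)) _).trans
      (le_count_mul hN h0 h2 h3 (B * (R + 1)))
    have h5 : (B : ℝ) * (R + 1) * (Nat.count G N - 1) + (R + 1) ≤
        Nat.count G (N * (B * (R + 1))) := by
      rw [← Nat.cast_one (R := ℝ), ← Nat.cast_sub hc]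
      exact_mod_cast (by simpa using h4)
    rw [div_le_div_iff₀ hN' (by positivity)]
    push_cast
    calc _ = ((B : ℝ) * (R + 1) * (Nat.count G N - 1) + (R + 1)) * N := by field_simp
      _ ≤ _ := by gcongr
  symm
  rw [Nat.ceil_eq_iff hc.ne', Nat.cast_sub hc, Nat.cast_one]
  have : 0 < 1 / (B : ℝ) := by positivity
  exact ⟨by linarith, hup⟩

end Density

section Translation

variable {j : ℕ}

lemma exists_length_gijBlock_chi (hj : 1 ≤ j)
    (hinf : {k : ℕ | curl (gPrefix (j + 1 + 1) k) ≤ j + 1}.Infinite) {L : ℕ}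
    (hL : curl (gPrefix (j + 1) L) ≤ j) :
    ∃ a, (gijBlock (j + 1) (chi (j + 1) a)).length = L := by
  obtain ⟨x, rfl⟩ := exists_eq_length_gijBlock (m := j + 1) (by omega) hinf (hL.trans (Nat.le_succ j))
  rw [gPrefix_length_gijBlock (by omega) hinf] at hL
  obtain ⟨a, rfl⟩ := exists_chi_eq (b := j + 1) (by omega) x fun p => by
    by_contra! hp
    have := le_curl_gijBlock (by omega) hp
    omega
  exact ⟨a, rfl⟩

lemma strictMono_length_gijBlock_chi (hj : 1 ≤ j) :
    StrictMono fun a => (gijBlock (j + 1) (chi (j + 1) a)).length :=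
  (strictMono_length_gijBlock (j + 1)).comp (chi_strictMono (by omega))

lemma tau_eq_length_gijBlock (hj : 1 ≤ j)
    (hinf₁ : {k : ℕ | curl (gPrefix (j + 1) k) ≤ j}.Infinite)
    (hinf₂ : {k : ℕ | curl (gPrefix (j + 1 + 1) k) ≤ j + 1}.Infinite) (x : ℕ) :
    tau j (x + 1) = (gijBlock (j + 1) (chi (j + 1) (Nat.nth (IsGood j) x))).length := by
  have h := Nat.nth_comp_of_strictMono (p := fun k => curl (gPrefix (j + 1) k) ≤ j) (n := x)
    (strictMono_length_gijBlock_chi hj) (fun k hk => exists_length_gijBlock_chi hj hinf₂ hk)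
    (fun hfi => absurd hfi hinf₁)
  simp only [gPrefix_length_gijBlock (show 1 ≤ j + 1 by omega) hinf₂] at h
  exact h.symm

lemma iota_eq_nth (hj : 1 ≤ j)
    (hinf₁ : {k : ℕ | curl (gPrefix (j + 1) k) ≤ j}.Infinite)
    (hinf₂ : {k : ℕ | curl (gPrefix (j + 1 + 1) k) ≤ j + 1}.Infinite) (x : ℕ) :
    iota j (x + 1) = Nat.nth (IsGood j) x := by
  rw [iota, Tstr, tau_eq_length_gijBlock hj hinf₁ hinf₂, gPrefix_length_gijBlock (by omega) hinf₂,
    count_gijBlock, digits_chi (b := j + 1) (by omega), Nat.ofDigits_digits]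

lemma infinite_isGood (hj : 1 ≤ j)
    (hinf₁ : {k : ℕ | curl (gPrefix (j + 1) k) ≤ j}.Infinite)
    (hinf₂ : {k : ℕ | curl (gPrefix (j + 1 + 1) k) ≤ j + 1}.Infinite) :
    {a | IsGood j a}.Infinite := by
  refine Set.Infinite.of_image (fun a => (gijBlock (j + 1) (chi (j + 1) a)).length)
    (hinf₁.mono fun L hL => ?_)
  obtain ⟨a, rfl⟩ := exists_length_gijBlock_chi hj hinf₂ hL
  refine ⟨a, ?_, rfl⟩
  have hL' : curl (gPrefix (j + 1) (gijBlock (j + 1) (chi (j + 1) a)).length) ≤ j := hL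
  rwa [gPrefix_length_gijBlock (by omega) hinf₂] at hL'

end Translation

section FirstOccurrence

variable {m n : ℕ}

lemma curl_append_singleton {S : List ℕ} (h : n ∉ S) : curl (S ++ [n]) = 1 := by
  refine le_antisymm ?_ (one_le_curl _)
  by_contra hcon
  obtain ⟨Y, hY, hs⟩ := (le_curl_iff (k := 2) le_rfl).1 (by omega : 2 ≤ curl (S ++ [n]))
  by_cases hn : n ∈ Y
  · have h1 := hs.sublist.count_le n
    rw [List.count_flatten, List.map_replicate, List.sum_replicate, smul_eq_mul,
      List.count_append, List.count_eq_zero.2 h] at h1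
    have h2 : 0 < Y.count n := List.count_pos_iff.2 hn
    have h3 : [n].count n = 1 := by simp
    omega
  · have h1 := (suffix_of_notMem (notMem_flatten_replicate hn) hs).length_le
    rw [length_flatten_replicate] at h1
    have := List.length_pos_iff.2 hY
    rw [List.length_nil] at h1
    omega

lemma notMem_gPrefix_of_lt_phi {L : ℕ} (h : L < phi m n) : n ∉ gPrefix m L := by
  induction L with
  | zero => simp [gPrefix]
  | succ L ih =>
    intro hn
    rw [gPrefix, List.mem_append, List.mem_singleton] at hn
    rcases hn with hn | hn
    · exact ih (by omega) hn
    · have : phi m n ≤ L + 1 := Nat.sInf_le ⟨by omega, hn.symm⟩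
      omega

lemma exists_gPrefix_phi (h : {p : ℕ | 1 ≤ p ∧ gij m p = n}.Nonempty) :
    ∃ S, n ∉ S ∧ gPrefix m (phi m n) = S ++ [n] := by
  obtain ⟨h1, h2⟩ : 1 ≤ phi m n ∧ gij m (phi m n) = n := Nat.sInf_mem h
  obtain ⟨L, hL⟩ := Nat.exists_eq_add_of_le' h1
  refine ⟨gPrefix m L, notMem_gPrefix_of_lt_phi (by omega), ?_⟩
  rw [hL] at h2 ⊢
  rw [gPrefix]
  congr 2

lemma phi_eq_of_gPrefix_eq {L : ℕ} {Z : List ℕ} (hZ : n ∉ Z) (h : gPrefix m L = Z ++ [n]) :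
    phi m n = L := by
  cases L with
  | zero => simp [gPrefix] at h
  | succ L =>
    rw [gPrefix] at h
    obtain ⟨h1, h2⟩ := List.append_inj' h rfl
    have hmem : L + 1 ∈ {p : ℕ | 1 ≤ p ∧ gij m p = n} :=
      ⟨by omega, List.singleton_inj.1 h2⟩
    refine le_antisymm (Nat.sInf_le hmem) ?_
    by_contra! hlt
    obtain ⟨S, -, hS⟩ := exists_gPrefix_phi ⟨_, hmem⟩
    have h3 := (gPrefix_prefix (m := m) (Nat.lt_succ_iff.1 hlt)).subset
    rw [hS, h1] at h3
    exact hZ (h3 (by simp))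

lemma phi_self (hm : 1 ≤ m) : phi m m = 1 :=
  phi_eq_of_gPrefix_eq (Z := []) (by simp) (by simp [gPrefix, curl_nil, hm])

variable (hinf : {k : ℕ | curl (gPrefix (m + 1) k) ≤ m}.Infinite)
include hinf

lemma tau_one (hm : 1 ≤ m) : tau m 1 = 0 := by
  obtain ⟨v, hv⟩ := exists_tau_eq hinf (l := 0) (by rw [gPrefix, curl_nil]; exact hm)
  have := (strictMono_length_Tstr hinf).monotone (Nat.zero_le v)
  simp only [length_Tstr] at this
  rw [zero_add] at this
  omega

lemma tau_two (hm : 1 ≤ m) : tau m 2 = 1 := by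
  obtain ⟨v, hv⟩ := exists_tau_eq hinf (l := 1) (by
    rw [show gPrefix (m + 1) 1 = [] ++ [m + 1] by simp [gPrefix, curl_nil],
      curl_append_singleton (by simp)]
    exact hm)
  have h0 := tau_one hinf hm
  have hmono : StrictMono fun v => tau m (v + 1) := by
    simpa only [length_Tstr] using strictMono_length_Tstr hinf
  have h1 : tau m 1 < tau m 2 := hmono Nat.zero_lt_one
  have hv0 : 1 ≤ v := by
    by_contra h
    obtain rfl : v = 0 := by omega
    rw [zero_add] at hv
    omega
  have h2 : tau m 2 ≤ tau m (v + 1) := hmono.monotone hv0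
  omega

lemma exists_tau_eq_phi (hm : 1 ≤ m) (h : {p : ℕ | 1 ≤ p ∧ gij (m + 1) p = n}.Nonempty) :
    ∃ K, tau m (K + 1) = phi (m + 1) n := by
  obtain ⟨S, hS, hS'⟩ := exists_gPrefix_phi h
  exact exists_tau_eq hinf (by rw [hS', curl_append_singleton hS]; exact hm)

lemma notMem_Tstr_of_lt {K : ℕ} (hK : tau m (K + 1) = phi (m + 1) n) {v : ℕ} (hv : v < K) :
    n ∉ Tstr m (v + 1) := by
  have := strictMono_length_Tstr hinf hv
  simp only [length_Tstr] at this
  exact notMem_gPrefix_of_lt_phi (by omega)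

lemma phi_eq_length_gijBlock (hm : 1 ≤ m) (hmn : m ≠ n)
    (h : {p : ℕ | 1 ≤ p ∧ gij (m + 1) p = n}.Nonempty) {K : ℕ}
    (hK : tau m (K + 1) = phi (m + 1) n) :
    phi m n = (gijBlock m ((m + 1) ^ K)).length := by
  obtain ⟨S, hS, hS'⟩ := exists_gPrefix_phi h
  have hlt : ∀ x < (m + 1) ^ K, n ∉ gijBlock m x := by
    intro x
    induction x with
    | zero => simp [gijBlock, joinGaps, rulerGap]
    | succ x ih =>
      intro hx
      have hv : multiplicity (m + 1) (x + 1) < K := by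
        by_contra! hv
        have := Nat.le_of_dvd (by omega)
          ((pow_dvd_iff_le_mult (b := m + 1) (by omega) (show 1 ≤ x + 1 by omega)).2 hv)
        omega
      rw [gijBlock_succ, List.mem_append, List.mem_cons]
      rintro (h1 | h1 | h1)
      · exact ih (by omega) h1
      · exact hmn h1.symm
      · exact notMem_Tstr_of_lt hinf hK hv h1
  have hpos : 0 < (m + 1) ^ K := Nat.pow_pos (by omega)
  refine phi_eq_of_gPrefix_eq (Z := gijBlock m ((m + 1) ^ K - 1) ++ m :: S) ?_ ?_
  · rw [List.mem_append, List.mem_cons]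
    rintro (h1 | h1 | h1)
    · exact hlt _ (by omega) h1
    · exact hmn h1.symm
    · exact hS h1
  · rw [gPrefix_length_gijBlock hm hinf]
    obtain ⟨x, hx⟩ := Nat.exists_eq_add_of_le' hpos
    have hmult : multiplicity (m + 1) (x + 1) = K :=
      mult_eq_of (by omega) (by omega) (by rw [hx]) fun h => by
        rw [← hx.trans rfl, Nat.pow_dvd_pow_iff_le_right (by omega)] at h
        omega
    rw [hx, Nat.add_sub_cancel, gijBlock_succ, hmult, Tstr, hK, hS']
    simp

lemma tfun_eq (hm : 1 ≤ m) (hmn : m ≠ n)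
    (h : {p : ℕ | 1 ≤ p ∧ gij (m + 1) p = n}.Nonempty) {K : ℕ}
    (hK : tau m (K + 1) = phi (m + 1) n) : tfun m n = 1 + K := by
  rw [tfun, phi_eq_length_gijBlock hinf hm hmn h hK, gPrefix_length_gijBlock hm hinf,
    count_gijBlock, Nat.log_pow (by omega)]

end FirstOccurrence

lemma tau_ceil_eq_phi {j k n : ℕ} (hj : 1 ≤ j) (hjn : j + 1 ≠ n)
    (hinf₁ : {k : ℕ | curl (gPrefix (j + 1) k) ≤ j}.Infinite)
    (hinf₂ : {k : ℕ | curl (gPrefix (j + 1 + 1) k) ≤ j + 1}.Infinite) {ν : ℝ}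
    (hν : Tendsto (fun x : ℕ => (x : ℝ) / (iota j x : ℝ)) atTop (nhds ν))
    (h₁ : {p : ℕ | 1 ≤ p ∧ gij (j + 1) p = n}.Nonempty)
    (h₂ : {p : ℕ | 1 ≤ p ∧ gij (j + 1 + 1) p = n}.Nonempty)
    (hk : tau (j + 1) (k + 1) = phi (j + 1 + 1) n) :
    tau j (⌈ν * ((j : ℝ) + 1) ^ k⌉₊ + 1) = phi (j + 1) n := by
  obtain ⟨K, hK⟩ := exists_tau_eq_phi hinf₁ hj h₁
  have hgood := infinite_isGood hj hinf₁ hinf₂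
  have hnth : Nat.nth (IsGood j) K = (j + 1) ^ k := by
    have h := tau_eq_length_gijBlock hj hinf₁ hinf₂ K
    rw [hK, phi_eq_length_gijBlock hinf₂ (by omega) hjn h₂ hk, ← chi_pow (by omega)] at h
    exact ((strictMono_length_gijBlock_chi hj).injective h).symm
  obtain ⟨S, hS, hS'⟩ := exists_gPrefix_phi h₂
  have hT : Tstr (j + 1) (k + 1) = S ++ [n] := by rw [Tstr, hk, hS']
  obtain ⟨L, hL, hLc⟩ := exists_isGood_pow_mul hj hinf₂
    (by rw [hT]; exact curl_append_singleton hS)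
  have hlim := hν.comp (tendsto_add_atTop_nat 1)
  simp only [Function.comp_def, iota_eq_nth hj hinf₁ hinf₂] at hlim
  have hcount := count_eq_ceil (G := IsGood j) (N := (j + 1) ^ k) (B := (j + 1) ^ L)
    (Nat.pow_pos (by omega)) (Nat.one_lt_pow (by omega) (by omega)) (isGood_zero hj)
    (fun r c hr => isGood_of_add hj hr)
    (fun r c hr hr0 => isGood_add hj hinf₂ (by rw [hT]; simp)
      (fun v hv => notMem_Tstr_of_lt hinf₂ hk hv) hr hr0)
    hLc (tendsto_count_div hgood hlim)
  rw [← hnth, Nat.count_nth_of_infinite hgood, hnth] at hcount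
  push_cast at hcount
  rw [← hcount, hK]

/-- Theorem `t tower`. For `1 ≤ m ≤ n−2`, `(m,n) ≠ (1,3)`:
`t^(m)(n) = 1 + ⌈ν_m·(m+1)^{⌈ν_{m+1}·(m+2)^{···^{⌈ν_{n−2}·(n−1)⌉}}⌉}⌉`, where the
exponents `E_j` are defined by downward recursion from `E_{n−2} = ⌈ν_{n−2}·(n−1)⌉`. -/
theorem statement11 (hSH : StandingHyp) (m n : ℕ) (hm : 1 ≤ m) (hmn : m + 2 ≤ n)
    (hne : ¬(m = 1 ∧ n = 3))
    (ν : ℕ → ℝ)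
    (hν : ∀ j, 1 ≤ j →
      Tendsto (fun x : ℕ => (x : ℝ) / (iota j x : ℝ)) atTop (nhds (ν j)))
    (hocc : ∀ l, m ≤ l → l ≤ n → {p : ℕ | 1 ≤ p ∧ gij l p = n}.Nonempty)
    (E : ℕ → ℕ)
    (hEtop : E (n - 2) = ⌈ν (n - 2) * ((n : ℝ) - 1)⌉₊)
    (hEstep : ∀ j, m ≤ j → j + 3 ≤ n → E j = ⌈ν j * ((j : ℝ) + 1) ^ E (j + 1)⌉₊) :
    tfun m n = 1 + E m := by
  have hinf : ∀ l, 1 ≤ l → {k : ℕ | curl (gPrefix (l + 1) k) ≤ l}.Infinite :=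
    fun l hl => (hSH l hl).2
  have key : ∀ d, d + 2 ≤ n → m ≤ n - 2 - d →
      tau (n - 2 - d) (E (n - 2 - d) + 1) = phi (n - 2 - d + 1) n := by
    intro d
    induction d with
    | zero =>
      intro _ _
      obtain ⟨j, rfl⟩ := Nat.exists_eq_add_of_le' (show 2 ≤ n by omega)
      rw [Nat.sub_zero, Nat.add_sub_cancel] at *
      have h := tau_ceil_eq_phi (k := 1) (n := j + 2) (by omega) (by omega) (hinf j (by omega))
        (hinf (j + 1) (by omega)) (hν j (by omega)) (hocc _ (by omega) (by omega))
        (hocc _ (by omega) le_rfl)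
        ((tau_two (hinf (j + 1) (by omega)) (by omega)).trans (phi_self (by omega)).symm)
      rw [hEtop]
      convert h using 5
      push_cast
      ring
    | succ d ih =>
      intro h1 h2
      obtain ⟨j, hj⟩ : ∃ j, j = n - 2 - (d + 1) := ⟨_, rfl⟩
      have ih' := ih (by omega) (by omega)
      rw [show n - 2 - d = j + 1 by omega] at ih'
      rw [← hj] at h2 ⊢
      rw [hEstep j h2 (by omega)]
      exact tau_ceil_eq_phi (by omega) (by omega) (hinf j (by omega))
        (hinf (j + 1) (by omega)) (hν j (by omega)) (hocc _ (by omega) (by omega))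
        (hocc _ (by omega) (by omega)) ih'
  have h := key (n - 2 - m) (by omega) (by omega)
  rw [show n - 2 - (n - 2 - m) = m by omega] at h
  exact tfun_eq (hinf m hm) hm (by omega) (hocc _ (by omega) (by omega)) h
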